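/- (Exact recovery with any positive regularization weight.) Let Ω ⊂ ℝ^d be a compact set, c : Ω × Ω → ℝ a continuous cost function, and ρ, μ, ν Borel probability measures on Ω with Spt(μ) ⊆ Spt(ρ). Let Δ be a function on pairs of Borel probability measures on Ω with Δ ≥ 0 and Δ(α, β) = 0 if and only if α = β. Let λ > 0 and let T : Ω → Ω be a continuous map. If Δ(T♯μ, ν) + λ · M^c_ρ(T) = 0, then T♯μ = ν and T is a c-optimal transport map between μ and ν, i.e., ∫_Ω c(x, T(x)) dμ(x) = W_c(μ, ν). -/

import Mathlib

open MeasureTheory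

/-- The Kantorovich optimal transport cost: infimum of `∫∫ c dπ` over couplings `π`
of `μ` and `ν`. -/
noncomputable def kantorovichCost {α β : Type*} [MeasurableSpace α] [MeasurableSpace β]
    (c : α → β → ℝ) (μ : Measure α) (ν : Measure β) : ℝ :=
  sInf {r : ℝ | ∃ π : Measure (α × β), IsProbabilityMeasure π ∧
    π.map Prod.fst = μ ∧ π.map Prod.snd = ν ∧ r = ∫ p, c p.1 p.2 ∂π}

/-- The Monge gap of a map `T` with reference measure `ρ` and cost `c`. -/
noncomputable def mongeGap {α : Type*} [MeasurableSpace α]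
    (c : α → α → ℝ) (ρ : Measure α) (T : α → α) : ℝ :=
  (∫ x, c x (T x) ∂ρ) - kantorovichCost c ρ (ρ.map T)

/-- The topological support of a Borel measure. -/
def measureSupport {α : Type*} [TopologicalSpace α] [MeasurableSpace α]
    (μ : Measure α) : Set α :=
  {x | ∀ U : Set α, x ∈ U → IsOpen U → 0 < μ U}

theorem Continuous.integrable_of_compactSpace {X : Type*} [TopologicalSpace X] [CompactSpace X]
    [MeasurableSpace X] [OpensMeasurableSpace X] {f : X → ℝ} (hf : Continuous f) (μ : Measure X)
    [IsFiniteMeasure μ] : Integrable f μ :=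
  hf.integrable_of_hasCompactSupport (HasCompactSupport.of_compactSpace f)

theorem Continuous.exists_abs_le_of_compactSpace {X : Type*} [TopologicalSpace X]
    [CompactSpace X] {f : X → ℝ} (hf : Continuous f) :
    ∃ M, ∀ x, |f x| ≤ M := by
  obtain ⟨M, hM⟩ := isCompact_univ.exists_bound_of_continuousOn hf.continuousOn
  exact ⟨M, fun x => hM x (Set.mem_univ x)⟩

theorem measureSupport_eq_support {X : Type*} [TopologicalSpace X] [MeasurableSpace X]
    (μ : Measure X) : measureSupport μ = μ.support := by
  ext x
  rw [Measure.mem_support_iff_forall]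
  refine ⟨fun h U hU => ?_, fun h U hx hU => h U (hU.mem_nhds hx)⟩
  obtain ⟨V, hVU, hV, hx⟩ := mem_nhds_iff.1 hU
  exact (h V hx hV).trans_le (measure_mono hVU)

theorem MeasureTheory.Measure.map_finsetSum_apply {α β ι : Type*} [MeasurableSpace α]
    [MeasurableSpace β] (s : Finset ι) (μ : ι → Measure α) {f : α → β} (hf : Measurable f) :
    (∑ i ∈ s, μ i).map f = ∑ i ∈ s, (μ i).map f := by
  classical
  induction s using Finset.induction_on with
  | empty => simp
  | insert a s ha ih => rw [Finset.sum_insert ha, Finset.sum_insert ha, Measure.map_add _ _ hf, ih]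

theorem map_graph_fst {X Y : Type*} [MeasurableSpace X] [MeasurableSpace Y] (μ : Measure X)
    {T : X → Y} (hT : Measurable T) :
    (μ.map fun x => (x, T x)).map Prod.fst = μ := by
  rw [Measure.map_map measurable_fst (by fun_prop)]
  exact Measure.map_id

theorem map_graph_snd {X Y : Type*} [MeasurableSpace X] [MeasurableSpace Y] (μ : Measure X)
    {T : X → Y} (hT : Measurable T) :
    (μ.map fun x => (x, T x)).map Prod.snd = μ.map T := by
  rw [Measure.map_map measurable_snd (by fun_prop)]
  rfl

theorem integral_map_graph {X : Type*} [TopologicalSpace X] [SecondCountableTopology X]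
    [MeasurableSpace X] [BorelSpace X] {c : X → X → ℝ} (hc : Continuous (Function.uncurry c))
    (μ : Measure X) {T : X → X} (hT : Measurable T) :
    ∫ p, c p.1 p.2 ∂(μ.map fun x => (x, T x)) = ∫ x, c x (T x) ∂μ :=
  integral_map (by fun_prop) hc.measurable.aestronglyMeasurable

/-- Rüschendorf's potential: a cyclically monotone graph over `S` is contained in the
`c`-superdifferential of a bounded measurable function. -/
theorem exists_potential_of_cyclicallyMonotone {X : Type*} [TopologicalSpace X] [CompactSpace X]
    [MeasurableSpace X] [OpensMeasurableSpace X] {c : X → X → ℝ}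
    (hc : Continuous (Function.uncurry c)) {T : X → X} {S : Set X} (hS : S.Nonempty)
    (hcm : ∀ s : ℕ → X, (∀ i, s i ∈ S) → ∀ n, s n = s 0 →
      0 ≤ ∑ i ∈ Finset.range n, (c (s (i + 1)) (T (s i)) - c (s i) (T (s i)))) :
    ∃ φ : X → ℝ, Measurable φ ∧ (∃ M, ∀ x, |φ x| ≤ M) ∧
      ∀ x, ∀ y ∈ S, φ x ≤ φ y + (c x (T y) - c y (T y)) := by
  obtain ⟨x₀, hx₀⟩ := hS
  obtain ⟨M, hM⟩ := hc.exists_abs_le_of_compactSpace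
  have hM' : ∀ x y, -M ≤ c x y ∧ c x y ≤ M := fun x y => abs_le.1 (hM (x, y))
  let ι := {p : ℕ × (ℕ → X) // (∀ i, p.2 i ∈ S) ∧ p.2 0 = x₀}
  let F : ι → X → ℝ := fun p x =>
    ∑ i ∈ Finset.range p.1.1, (c (p.1.2 (i + 1)) (T (p.1.2 i)) - c (p.1.2 i) (T (p.1.2 i))) +
      (c x (T (p.1.2 p.1.1)) - c (p.1.2 p.1.1) (T (p.1.2 p.1.1)))
  let p₀ : ι := ⟨(0, fun _ => x₀), fun _ => hx₀, rfl⟩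
  have : Nonempty ι := ⟨p₀⟩
  have hFlow : ∀ p x, -(2 * M) ≤ F p x := by
    rintro ⟨⟨n, s⟩, hs, hs0⟩ x
    have h := hcm (fun i => if i ≤ n then s i else x₀)
      (fun i => by split_ifs; exacts [hs i, hx₀]) (n + 1) (by simpa using hs0.symm)
    rw [Finset.sum_range_succ, Finset.sum_congr rfl (g := fun i =>
      c (s (i + 1)) (T (s i)) - c (s i) (T (s i))) (fun i hi => by
        have := Finset.mem_range.1 hi
        simp [Nat.succ_le_of_lt this, this.le])] at h
    simp only [le_refl, if_true, Nat.not_succ_le_self, if_false] at h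
    have h1 := (hM' x (T (s n))).1
    have h2 := (hM' x₀ (T (s n))).2
    simp only [F]
    linarith
  have hbdd : ∀ x, BddBelow (Set.range fun p => F p x) := fun x =>
    ⟨-(2 * M), by rintro _ ⟨p, rfl⟩; exact hFlow p x⟩
  refine ⟨fun x => ⨅ p, F p x, ?_, ⟨2 * M, fun x => abs_le.2 ⟨le_ciInf fun p => hFlow p x, ?_⟩⟩, ?_⟩
  · refine (upperSemicontinuous_ciInf hbdd fun p => ?_).measurable
    refine Continuous.upperSemicontinuous ?_
    exact continuous_const.add
      ((hc.comp (continuous_id.prodMk continuous_const)).sub continuous_const)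
  · refine (ciInf_le (hbdd x) p₀).trans ?_
    have h1 := (hM' x (T x₀)).2
    have h2 := (hM' x₀ (T x₀)).1
    simp only [F, p₀, Finset.range_zero, Finset.sum_empty]
    linarith
  · intro x y hy
    rw [← sub_le_iff_le_add]
    refine le_ciInf ?_
    rintro ⟨⟨n, s⟩, hs, hs0⟩
    let q : ι := ⟨(n + 1, fun i => if i ≤ n then s i else y),
      fun i => by dsimp only; split_ifs; exacts [hs i, hy], by simpa using hs0⟩
    have h := ciInf_le (hbdd x) q
    have hq : F q x = F ⟨(n, s), hs, hs0⟩ y + (c x (T y) - c y (T y)) := by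
      simp only [F, q]
      rw [Finset.sum_range_succ, Finset.sum_congr rfl (g := fun i =>
        c (s (i + 1)) (T (s i)) - c (s i) (T (s i))) (fun i hi => by
          have := Finset.mem_range.1 hi
          simp [Nat.succ_le_of_lt this, this.le])]
      simp
    linarith

section

variable {X : Type*} [MetricSpace X] [CompactSpace X] [MeasurableSpace X] [BorelSpace X]
  [SecondCountableTopology X] {c : X → X → ℝ}

theorem kantorovichCost_le_integral (hc : Continuous (Function.uncurry c)) {μ ν : Measure X}
    (π : Measure (X × X)) [IsProbabilityMeasure π] (h₁ : π.map Prod.fst = μ)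
    (h₂ : π.map Prod.snd = ν) : kantorovichCost c μ ν ≤ ∫ p, c p.1 p.2 ∂π := by
  obtain ⟨M, hM⟩ := hc.exists_abs_le_of_compactSpace
  refine csInf_le ⟨-M, ?_⟩ ⟨π, inferInstance, h₁, h₂, rfl⟩
  rintro r ⟨π', hπ', -, -, rfl⟩
  calc -M = ∫ _, -M ∂π' := by simp
    _ ≤ _ := integral_mono (integrable_const _) (hc.integrable_of_compactSpace π')
      fun p => (abs_le.1 (hM p)).1

theorem kantorovichCost_le_integral_map (hc : Continuous (Function.uncurry c)) (μ : Measure X)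
    [IsProbabilityMeasure μ] {T : X → X} (hT : Continuous T) :
    kantorovichCost c μ (μ.map T) ≤ ∫ x, c x (T x) ∂μ := by
  have : IsProbabilityMeasure (μ.map fun x => (x, T x)) :=
    Measure.isProbabilityMeasure_map (by fun_prop)
  rw [← integral_map_graph hc μ hT.measurable]
  exact kantorovichCost_le_integral hc _ (map_graph_fst μ hT.measurable)
    (map_graph_snd μ hT.measurable)

/-- Optimality of a transport map is inherited by measures dominated by the source measure. -/
theorem integral_le_of_le {ρ : Measure X} [IsProbabilityMeasure ρ]
    (hc : Continuous (Function.uncurry c)) {T : X → X} (hT : Continuous T)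
    (hopt : ∫ x, c x (T x) ∂ρ ≤ kantorovichCost c ρ (ρ.map T))
    {α : Measure X} (hα : α ≤ ρ) (γ : Measure (X × X)) [IsFiniteMeasure γ]
    (h₁ : γ.map Prod.fst = α) (h₂ : γ.map Prod.snd = α.map T) :
    ∫ x, c x (T x) ∂α ≤ ∫ p, c p.1 p.2 ∂γ := by
  have : IsFiniteMeasure α := isFiniteMeasure_of_le ρ hα
  set β := ρ - α
  have hβ : β + α = ρ := Measure.sub_add_cancel_of_le hα
  have : IsFiniteMeasure β := isFiniteMeasure_of_le ρ (hβ ▸ Measure.le_add_right le_rfl)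
  set π := β.map (fun x => (x, T x)) + γ with hπ
  have hπ₁ : π.map Prod.fst = ρ := by
    rw [hπ, Measure.map_add _ _ measurable_fst, map_graph_fst β hT.measurable, h₁, hβ]
  have hπ₂ : π.map Prod.snd = ρ.map T := by
    rw [hπ, Measure.map_add _ _ measurable_snd, map_graph_snd β hT.measurable, h₂,
      ← Measure.map_add _ _ hT.measurable, hβ]
  have : IsProbabilityMeasure π := by
    constructor
    have := measure_univ (μ := ρ)
    rwa [← hπ₁, Measure.map_apply measurable_fst .univ] at this
  have key := hopt.trans (kantorovichCost_le_integral hc π hπ₁ hπ₂)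
  have hcT : Continuous fun x => c x (T x) := hc.comp (continuous_id.prodMk hT)
  have hc' : Continuous fun p : X × X => c p.1 p.2 := hc
  rw [hπ, integral_add_measure (hc'.integrable_of_compactSpace _)
      (hc'.integrable_of_compactSpace _),
    integral_map_graph hc β hT.measurable, ← hβ,
    integral_add_measure (hcT.integrable_of_compactSpace _) (hcT.integrable_of_compactSpace _)]
    at key
  linarith

theorem integral_le_of_le_smul {ρ : Measure X} [IsProbabilityMeasure ρ]
    (hc : Continuous (Function.uncurry c)) {T : X → X} (hT : Continuous T)
    (hopt : ∫ x, c x (T x) ∂ρ ≤ kantorovichCost c ρ (ρ.map T))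
    {K : ENNReal} (hK₀ : K ≠ 0) (hK : K ≠ ⊤)
    {α : Measure X} (hα : α ≤ K • ρ) (γ : Measure (X × X)) [IsFiniteMeasure γ]
    (h₁ : γ.map Prod.fst = α) (h₂ : γ.map Prod.snd = α.map T) :
    ∫ x, c x (T x) ∂α ≤ ∫ p, c p.1 p.2 ∂γ := by
  have hK' : K⁻¹ ≠ ⊤ := ENNReal.inv_ne_top.2 hK₀
  have : IsFiniteMeasure (K⁻¹ • γ) := Measure.smul_finite γ hK'
  have hle : K⁻¹ • α ≤ ρ := by
    intro s
    have := hα s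
    simp only [Measure.smul_apply, smul_eq_mul] at this ⊢
    calc K⁻¹ * α s ≤ K⁻¹ * (K * ρ s) := by gcongr
      _ = ρ s := by rw [← mul_assoc, ENNReal.inv_mul_cancel hK₀ hK, one_mul]
  have key := integral_le_of_le hc hT hopt hle (K⁻¹ • γ)
    (by rw [Measure.map_smul, h₁]) (by rw [Measure.map_smul, Measure.map_smul, h₂])
  rw [integral_smul_measure, integral_smul_measure] at key
  exact le_of_mul_le_mul_left key
    (ENNReal.toReal_pos (ENNReal.inv_ne_zero.2 hK) hK')

/-- The graph of an optimal map is cyclically monotone over the support of the source measure. -/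
theorem cyclicallyMonotone_of_optimal {ρ : Measure X} [IsProbabilityMeasure ρ]
    (hc : Continuous (Function.uncurry c)) {T : X → X} (hT : Continuous T)
    (hopt : ∫ x, c x (T x) ∂ρ ≤ kantorovichCost c ρ (ρ.map T))
    (s : ℕ → X) (hs : ∀ i, s i ∈ ρ.support) (n : ℕ) (hn : s n = s 0) :
    0 ≤ ∑ i ∈ Finset.range n, (c (s (i + 1)) (T (s i)) - c (s i) (T (s i))) := by
  have hcT : Continuous fun x => c x (T x) := hc.comp (continuous_id.prodMk hT)
  have hcT' : Continuous fun p : X × X => c p.1 (T p.2) :=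
    hc.comp (continuous_fst.prodMk (hT.comp continuous_snd))
  have hcT₂ : Continuous fun p : X × X => c p.2 (T p.2) := hcT.comp continuous_snd
  set g : X × X → ℝ := fun p => c p.1 (T p.2) - c p.2 (T p.2)
  have hgc : Continuous g := hcT'.sub hcT₂
  have hgu := Metric.uniformContinuous_iff.1 (CompactSpace.uniformContinuous_of_continuous hgc)
  suffices h : ∀ η > 0, -(n * η) ≤ ∑ i ∈ Finset.range n, g (s (i + 1), s i) by
    by_contra! hneg
    change ∑ i ∈ Finset.range n, g (s (i + 1), s i) < 0 at hneg
    set S := ∑ i ∈ Finset.range n, g (s (i + 1), s i)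
    have h1 := h (-S / (n + 1)) (by apply div_pos <;> [linarith; positivity])
    have h2 : (n : ℝ) * (-S / (n + 1)) < -S := by
      rw [mul_div_assoc', div_lt_iff₀ (by positivity)]
      linarith
    linarith
  intro η hη
  obtain ⟨δ, hδ, hgδ⟩ := hgu η hη
  set B : ℕ → Set X := fun i => Metric.ball (s i) δ
  have hB : ∀ i, ρ (B i) ≠ 0 := fun i =>
    ((Measure.mem_support_iff_forall _).1 (hs i) _ (Metric.ball_mem_nhds _ hδ)).ne'
  set σ : ℕ → Measure X := fun i => ProbabilityTheory.cond ρ (B i) with hσ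
  have hσp : ∀ i, IsProbabilityMeasure (σ i) := fun i =>
    ProbabilityTheory.cond_isProbabilityMeasure (hB i)
  have hσB : ∀ i, ∀ᵐ x ∂σ i, x ∈ B i := fun i =>
    ProbabilityTheory.ae_cond_mem Metric.isOpen_ball.measurableSet
  have hmeas : Measurable (Prod.map id T : X × X → X × X) := measurable_id.prodMap hT.measurable
  set τ : ℕ → Measure (X × X) := fun i => ((σ (i + 1)).prod (σ i)).map (Prod.map id T)
  have hτp : ∀ i, IsProbabilityMeasure (τ i) := fun i =>
    Measure.isProbabilityMeasure_map hmeas.aemeasurable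
  have hτ₁ : ∀ i, (τ i).map Prod.fst = σ (i + 1) := fun i => by
    rw [Measure.map_map measurable_fst hmeas]
    change ((σ (i + 1)).prod (σ i)).map Prod.fst = _
    simp
  have hτ₂ : ∀ i, (τ i).map Prod.snd = (σ i).map T := fun i => by
    rw [Measure.map_map measurable_snd hmeas]
    change ((σ (i + 1)).prod (σ i)).map (T ∘ Prod.snd) = _
    rw [← Measure.map_map hT.measurable measurable_snd]
    simp
  have hτint : ∀ i, ∫ p, c p.1 p.2 ∂τ i - ∫ x, c x (T x) ∂σ i ≤ g (s (i + 1), s i) + η := by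
    intro i
    have e1 : ∫ p, c p.1 p.2 ∂τ i = ∫ p, c p.1 (T p.2) ∂(σ (i + 1)).prod (σ i) :=
      integral_map hmeas.aemeasurable hc.aestronglyMeasurable
    have e2 : ∫ x, c x (T x) ∂σ i = ∫ p, c p.2 (T p.2) ∂(σ (i + 1)).prod (σ i) := by
      have : ((σ (i + 1)).prod (σ i)).map Prod.snd = σ i := by simp
      conv_lhs => rw [← this]
      exact integral_map measurable_snd.aemeasurable hcT.aestronglyMeasurable
    rw [e1, e2, ← integral_sub (hcT'.integrable_of_compactSpace _)
      (hcT₂.integrable_of_compactSpace _)]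
    calc ∫ p, g p ∂(σ (i + 1)).prod (σ i)
        ≤ ∫ _, g (s (i + 1), s i) + η ∂(σ (i + 1)).prod (σ i) := by
          refine integral_mono_ae (hgc.integrable_of_compactSpace _) (integrable_const _) ?_
          filter_upwards [Measure.quasiMeasurePreserving_fst.ae (hσB (i + 1)),
            Measure.quasiMeasurePreserving_snd.ae (hσB i)] with p hp₁ hp₂
          have : dist p (s (i + 1), s i) < δ := by
            rw [Prod.dist_eq]
            exact max_lt hp₁ hp₂
          have := (abs_lt.1 (Real.dist_eq _ _ ▸ hgδ this)).2
          linarith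
      _ = _ := by simp
  set α := ∑ i ∈ Finset.range n, σ i with hα
  set γ := ∑ i ∈ Finset.range n, τ i with hγ
  have hγ₁ : γ.map Prod.fst = α := by
    rw [hγ, Measure.map_finsetSum_apply _ _ measurable_fst]
    simp_rw [hτ₁]
    have h1 := Finset.sum_range_succ σ n
    have h2 := Finset.sum_range_succ' σ n
    have h0 : σ n = σ 0 := by simp only [hσ, B, hn]
    rw [h2, h0] at h1
    exact Measure.add_left_inj (σ 0) _ _ |>.1 h1
  have hγ₂ : γ.map Prod.snd = α.map T := by
    rw [hγ, hα, Measure.map_finsetSum_apply _ _ measurable_snd,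
      Measure.map_finsetSum_apply _ _ hT.measurable]
    simp_rw [hτ₂]
  have hαle : α ≤ ((∑ i ∈ Finset.range n, (ρ (B i))⁻¹) + 1) • ρ := by
    intro t
    simp only [hα, Measure.coe_finsetSum, Finset.sum_apply, Measure.smul_apply, smul_eq_mul]
    rw [add_mul, Finset.sum_mul]
    refine le_add_right (Finset.sum_le_sum fun i _ => ?_)
    simp only [hσ, ProbabilityTheory.cond, Measure.smul_apply, smul_eq_mul]
    gcongr
    exact Measure.restrict_le_self
  have hK : (∑ i ∈ Finset.range n, (ρ (B i))⁻¹) + 1 ≠ ⊤ :=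
    ENNReal.add_ne_top.2 ⟨ENNReal.sum_ne_top.2 fun i _ => ENNReal.inv_ne_top.2 (hB i),
      ENNReal.one_ne_top⟩
  have key := integral_le_of_le_smul hc hT hopt (by simp) hK hαle γ hγ₁ hγ₂
  have hc' : Continuous fun p : X × X => c p.1 p.2 := hc
  rw [hα, hγ, integral_finsetSum_measure fun i _ => hcT.integrable_of_compactSpace _,
    integral_finsetSum_measure fun i _ => hc'.integrable_of_compactSpace _] at key
  have hsum := Finset.sum_le_sum fun i (_ : i ∈ Finset.range n) => hτint i
  rw [Finset.sum_sub_distrib, Finset.sum_add_distrib] at hsum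
  simp only [Finset.sum_const, Finset.card_range, nsmul_eq_mul] at hsum
  linarith

/-- A map whose graph lies, almost everywhere, in a `c`-superdifferential is optimal. -/
theorem integral_le_kantorovichCost_of_potential
    (hc : Continuous (Function.uncurry c)) {T : X → X} (hT : Continuous T)
    (μ : Measure X) [IsProbabilityMeasure μ] {φ : X → ℝ} (hφ : Measurable φ)
    (hφb : ∃ M, ∀ x, |φ x| ≤ M)
    (hle : ∀ᵐ y ∂μ, ∀ x, φ x ≤ φ y + (c x (T y) - c y (T y))) :
    ∫ x, c x (T x) ∂μ ≤ kantorovichCost c μ (μ.map T) := by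
  have hne : Nonempty X := nonempty_of_isProbabilityMeasure μ
  obtain ⟨M, hM⟩ := hc.exists_abs_le_of_compactSpace
  obtain ⟨N, hN⟩ := hφb
  have hM' : ∀ x y, -M ≤ c x y ∧ c x y ≤ M := fun x y => abs_le.1 (hM (x, y))
  have hN' : ∀ x, -N ≤ φ x ∧ φ x ≤ N := fun x => abs_le.1 (hN x)
  set ψ : X → ℝ := fun y => ⨅ x, (c x y - φ x)
  have hbdd : ∀ y, BddBelow (Set.range fun x => c x y - φ x) := fun y =>
    ⟨-(M + N), by rintro _ ⟨x, rfl⟩; linarith [(hM' x y).1, (hN' x).2]⟩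
  have hψm : Measurable ψ := by
    refine (upperSemicontinuous_ciInf hbdd fun x => ?_).measurable
    refine Continuous.upperSemicontinuous ?_
    exact (hc.comp (continuous_const.prodMk continuous_id)).sub continuous_const
  have hψb : ∀ y, ‖ψ y‖ ≤ M + N := by
    intro y
    let x := Classical.arbitrary X
    exact abs_le.2 ⟨le_ciInf fun x => by linarith [(hM' x y).1, (hN' x).2],
      (ciInf_le (hbdd y) x).trans (by linarith [(hM' x y).2, (hN' x).1])⟩
  have hφi : Integrable φ μ :=
    .of_bound hφ.aestronglyMeasurable N (.of_forall hN)
  have hcT : Continuous fun x => c x (T x) := hc.comp (continuous_id.prodMk hT)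
  have hgraph : IsProbabilityMeasure (μ.map fun x => (x, T x)) :=
    Measure.isProbabilityMeasure_map (by fun_prop)
  refine le_csInf ⟨_, _, hgraph, map_graph_fst μ hT.measurable, map_graph_snd μ hT.measurable, rfl⟩ ?_
  rintro r ⟨π, hπ, h₁, h₂, rfl⟩
  have hφπ : Integrable (fun p : X × X => φ p.1) π :=
    .of_bound (hφ.comp measurable_fst).aestronglyMeasurable N (.of_forall fun p => hN p.1)
  have hψπ : Integrable (fun p : X × X => ψ p.2) π :=
    .of_bound (hψm.comp measurable_snd).aestronglyMeasurable _ (.of_forall fun p => hψb p.2)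
  have hψT : Integrable (fun x => ψ (T x)) μ :=
    .of_bound (hψm.comp hT.measurable).aestronglyMeasurable _ (.of_forall fun x => hψb (T x))
  have e1 : ∫ p, φ p.1 ∂π = ∫ x, φ x ∂μ := by
    rw [← h₁, integral_map measurable_fst.aemeasurable hφ.aestronglyMeasurable]
  have e2 : ∫ p, ψ p.2 ∂π = ∫ x, ψ (T x) ∂μ := by
    rw [← integral_map hT.measurable.aemeasurable hψm.aestronglyMeasurable, ← h₂,
      integral_map measurable_snd.aemeasurable hψm.aestronglyMeasurable]
  calc ∫ x, c x (T x) ∂μ ≤ ∫ x, φ x + ψ (T x) ∂μ := by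
        refine integral_mono_ae (hcT.integrable_of_compactSpace μ)
          (hφi.add hψT) ?_
        filter_upwards [hle] with y hy
        have : c y (T y) - φ y ≤ ψ (T y) := le_ciInf fun x => by linarith [hy x]
        linarith
    _ = ∫ p, φ p.1 + ψ p.2 ∂π := by
        rw [integral_add hφi hψT, integral_add hφπ hψπ, e1, e2]
    _ ≤ ∫ p, c p.1 p.2 ∂π := by
        refine integral_mono (hφπ.add hψπ) (hc.integrable_of_compactSpace π) fun p => ?_
        have := ciInf_le (hbdd p.2) p.1
        change φ p.1 + ψ p.2 ≤ c p.1 p.2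
        linarith

end

/-- exact recovery with any positive regularization weight. If a
nonnegative, separating fitting loss `Δ` plus `λ` times the Monge gap vanishes at a
continuous map `T`, then `T♯μ = ν` and `T` is a `c`-optimal transport map between
`μ` and `ν`. -/
theorem exact_recovery_any_positive_weight {d : ℕ}
    (Ω : Set (EuclideanSpace ℝ (Fin d))) (hΩ : IsCompact Ω)
    (c : Ω → Ω → ℝ) (hc : Continuous (Function.uncurry c))
    (ρ μ ν : Measure Ω) (hρ : IsProbabilityMeasure ρ) (hμ : IsProbabilityMeasure μ)
    (hν : IsProbabilityMeasure ν)
    (hspt : measureSupport μ ⊆ measureSupport ρ)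
    (Δ : Measure Ω → Measure Ω → ℝ)
    (hΔ_nonneg : ∀ α β : Measure Ω, IsProbabilityMeasure α → IsProbabilityMeasure β →
      0 ≤ Δ α β)
    (hΔ_sep : ∀ α β : Measure Ω, IsProbabilityMeasure α → IsProbabilityMeasure β →
      (Δ α β = 0 ↔ α = β))
    (lam : ℝ) (hlam : 0 < lam)
    (T : Ω → Ω) (hT : Continuous T)
    (hzero : Δ (μ.map T) ν + lam * mongeGap c ρ T = 0) :
    μ.map T = ν ∧ (∫ x, c x (T x) ∂μ) = kantorovichCost c μ ν := by
  have : CompactSpace Ω := isCompact_iff_compactSpace.1 hΩ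
  have hgap : 0 ≤ mongeGap c ρ T := sub_nonneg.2 (kantorovichCost_le_integral_map hc ρ hT)
  have hmap : IsProbabilityMeasure (μ.map T) :=
    Measure.isProbabilityMeasure_map hT.measurable.aemeasurable
  have hΔ := hΔ_nonneg (μ.map T) ν hmap hν
  have hlg : 0 ≤ lam * mongeGap c ρ T := mul_nonneg hlam.le hgap
  have hfit : μ.map T = ν := (hΔ_sep _ _ hmap hν).1 (by linarith)
  have hgap₀ : mongeGap c ρ T ≤ 0 := by
    by_contra! h
    linarith [mul_pos hlam h]
  have hopt : ∫ x, c x (T x) ∂ρ ≤ kantorovichCost c ρ (ρ.map T) := sub_nonpos.1 hgap₀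
  rw [measureSupport_eq_support, measureSupport_eq_support] at hspt
  obtain ⟨φ, hφ, hφb, hle⟩ := exists_potential_of_cyclicallyMonotone hc
    (Measure.nonempty_support (IsProbabilityMeasure.ne_zero ρ))
    (cyclicallyMonotone_of_optimal hc hT hopt)
  refine ⟨hfit, hfit ▸ le_antisymm ?_ (kantorovichCost_le_integral_map hc μ hT)⟩
  refine integral_le_kantorovichCost_of_potential hc hT μ hφ hφb ?_
  filter_upwards [Measure.support_mem_ae (μ := μ)] with y hy x
  exact hle x y (hspt hy)
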